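/- If y₁, y₂ : [0,τ] → E are absolutely continuous and satisfy ẏᵢ(t) = b(t,yᵢ(t)) for a.e. t ∈ [0,τ] (i = 1,2), then the function t ↦ e^{M(t)} ‖y₁(t) − y₂(t)‖ is nondecreasing on [0,τ]; in particular ‖y₁(0) − y₂(0)‖ ≤ e^{M(τ)} ‖y₁(τ) − y₂(τ)‖. -/

import Mathlib

open MeasureTheory Set intervalIntegral

/-- Postcomposition of an absolutely continuous function with a Lipschitz function. -/
theorem LipschitzOnWith.comp_absolutelyContinuousOnInterval
    {X Y : Type*} [PseudoMetricSpace X] [PseudoMetricSpace Y] {g : X → Y} {K : NNReal} {s : Set X}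
    {f : ℝ → X} {a b : ℝ} (hg : LipschitzOnWith K g s)
    (hf : AbsolutelyContinuousOnInterval f a b) (hfs : MapsTo f (uIcc a b) s) :
    AbsolutelyContinuousOnInterval (fun x => g (f x)) a b := by
  have hlim := Filter.Tendsto.const_mul (K : ℝ) hf
  rw [mul_zero] at hlim
  refine squeeze_zero' (.of_forall fun _ => Finset.sum_nonneg fun _ _ => dist_nonneg) ?_ hlim
  refine Filter.eventually_inf_principal.2 (.of_forall fun I hI => ?_)
  rw [Finset.mul_sum]
  refine Finset.sum_le_sum fun i hi => ?_
  exact hg.dist_le_mul _ (hfs (hI.1 i hi).1) _ (hfs (hI.1 i hi).2)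

/-- The exponential of an absolutely continuous function is absolutely continuous. -/
theorem AbsolutelyContinuousOnInterval.exp {f : ℝ → ℝ} {a b : ℝ}
    (hf : AbsolutelyContinuousOnInterval f a b) :
    AbsolutelyContinuousOnInterval (fun x => Real.exp (f x)) a b := by
  obtain ⟨C, hC⟩ := hf.exists_bound
  obtain ⟨K, hK⟩ := (Real.contDiff_exp (n := 1)).contDiffOn.exists_lipschitzOnWith (by decide)
    (convex_Icc (-C) C) isCompact_Icc
  exact hK.comp_absolutelyContinuousOnInterval hf fun x hx => abs_le.1 (hC x hx)

/-- Backward Gronwall inequality in integral form, with an integrable coefficient. -/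
theorem le_exp_integral_mul_of_le_add_integral {L φ : ℝ → ℝ} {a c : ℝ} (hac : a ≤ c)
    (hL0 : ∀ t, 0 ≤ L t) (hL : IntervalIntegrable L volume a c)
    (hφ : ContinuousOn φ (Icc a c))
    (h : ∀ s ∈ Icc a c, φ s ≤ φ c + ∫ t in s..c, L t * φ t) :
    φ a ≤ Real.exp (∫ t in a..c, L t) * φ c := by
  have hLφ : IntervalIntegrable (fun t => L t * φ t) volume a c :=
    hL.mul_continuousOn (by rwa [uIcc_of_le hac])
  set m : ℝ → ℝ := fun x => ∫ t in a..x, L t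
  set I : ℝ → ℝ := fun x => ∫ t in a..x, L t * φ t with hI
  have hmac : AbsolutelyContinuousOnInterval m a c :=
    hL.absolutelyContinuousOnInterval_intervalIntegral left_mem_uIcc
  have hIac : AbsolutelyContinuousOnInterval I a c :=
    hLφ.absolutelyContinuousOnInterval_intervalIntegral left_mem_uIcc
  have hconst : AbsolutelyContinuousOnInterval (fun _ : ℝ => φ c + I c) a c :=
    (LipschitzWith.const (φ c + I c)).lipschitzOnWith.absolutelyContinuousOnInterval
  have hG := hmac.exp.fun_mul (hconst.fun_sub hIac)
  have hle : ∀ x ∈ Icc a c, φ x ≤ φ c + I c - I x := by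
    intro x hx
    have hsub := integral_interval_sub_left hLφ
      (hLφ.mono_set (uIcc_subset_uIcc_left (by rwa [uIcc_of_le hac])))
    have := h x hx
    simp only [hI]
    linarith
  have hderiv : 0 ≤ ∫ x in a..c, deriv (fun x => Real.exp (m x) * (φ c + I c - I x)) x := by
    refine integral_nonneg_of_ae_restrict hac ?_
    rw [Filter.EventuallyLE, ae_restrict_iff' measurableSet_Icc]
    filter_upwards [hL.ae_hasDerivAt_integral, hLφ.ae_hasDerivAt_integral] with x hx₁ hx₂ hx
    have hx' : x ∈ uIcc a c := by rwa [uIcc_of_le hac]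
    have hd := (hx₁ hx' a left_mem_uIcc).exp.mul
      ((hx₂ hx' a left_mem_uIcc).const_sub (φ c + I c))
    have hd' : HasDerivAt (fun x => Real.exp (m x) * (φ c + I c - I x))
        (Real.exp (m x) * L x * (φ c + I c - I x) + Real.exp (m x) * -(L x * φ x)) x := hd
    rw [hd'.deriv]
    have : 0 ≤ Real.exp (m x) * L x * (φ c + I c - I x - φ x) :=
      mul_nonneg (mul_nonneg (Real.exp_nonneg _) (hL0 x)) (sub_nonneg.2 (hle x hx))
    simp only [Pi.zero_apply]
    linarith
  rw [hG.integral_deriv_eq_sub] at hderiv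
  have ha := hle a (left_mem_Icc.2 hac)
  have hIa : I a = 0 := integral_same
  have hma : m a = 0 := integral_same
  rw [hma, hIa, Real.exp_zero] at hderiv
  rw [hIa] at ha
  linarith

/-- Backward Gronwall inequality for an integral curve `w` whose velocity `g` is bounded by
`L * ‖w‖`. -/
theorem norm_le_exp_integral_mul_norm {E : Type*} [NormedAddCommGroup E] [NormedSpace ℝ E]
    {L : ℝ → ℝ} {w g : ℝ → E} {a c : ℝ} (hac : a ≤ c)
    (hL0 : ∀ t, 0 ≤ L t) (hL : IntervalIntegrable L volume a c)
    (hw : ContinuousOn w (Icc a c)) (hg : ∀ t ∈ Icc a c, ‖g t‖ ≤ L t * ‖w t‖)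
    (h : ∀ s ∈ Icc a c, w c = w s + ∫ t in s..c, g t) :
    ‖w a‖ ≤ Real.exp (∫ t in a..c, L t) * ‖w c‖ := by
  refine le_exp_integral_mul_of_le_add_integral (φ := fun t => ‖w t‖) hac hL0 hL hw.norm
    fun s hs => ?_
  have hLw : IntervalIntegrable (fun t => L t * ‖w t‖) volume a c :=
    hL.mul_continuousOn (by rw [uIcc_of_le hac]; exact hw.norm)
  have hbound : ‖∫ t in s..c, g t‖ ≤ ∫ t in s..c, L t * ‖w t‖ :=
    norm_integral_le_of_norm_le hs.2 (.of_forall fun t ht => hg t ⟨hs.1.trans ht.1.le, ht.2⟩)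
      (hLw.mono_set (uIcc_subset_uIcc_right (by rwa [uIcc_of_le hac])))
  have hws : w s = w c - ∫ t in s..c, g t := by rw [h s hs]; abel
  calc ‖w s‖ = ‖w c - ∫ t in s..c, g t‖ := by rw [← hws]
    _ ≤ ‖w c‖ + ‖∫ t in s..c, g t‖ := norm_sub_le _ _
    _ ≤ ‖w c‖ + ∫ t in s..c, L t * ‖w t‖ := by gcongr

/-- A Carathéodory function evaluated along a continuous curve is strongly measurable. -/
theorem ContinuousOn.aestronglyMeasurable_caratheodory {E : Type*} [NormedAddCommGroup E]
    [NormedSpace ℝ E] [FiniteDimensional ℝ E] [MeasurableSpace E] [BorelSpace E]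
    {b : ℝ → E → E} (hbmeas : ∀ y : E, Measurable fun t => b t y)
    (hbcont : ∀ t : ℝ, Continuous fun y => b t y) {y : ℝ → E} {s : Set ℝ}
    (hs : MeasurableSet s) (hy : ContinuousOn y s) :
    AEStronglyMeasurable (fun t => b t (y t)) (volume.restrict s) := by
  have hb : Measurable (Function.uncurry fun y t => b t y) :=
    measurable_uncurry_of_continuous_of_measurable hbcont hbmeas
  have hyt : AEMeasurable (fun t => (y t, t)) (volume.restrict s) :=
    (hy.aemeasurable hs).prodMk aemeasurable_id
  exact (hb.comp_aemeasurable hyt).aestronglyMeasurable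

/-- Let `r ∈ S` and `t ∉ S` with `r ≤ t`. If on `[r, t]` the continuous function `φ` is at least
`φ r` on `S`, and the continuous function `w` equals `w₀` off `S`, then some `c ∈ [r, t]` satisfies
both `φ r ≤ φ c` and `w c = w₀`. -/
theorem exists_le_and_eq_of_notMem {E : Type*} [TopologicalSpace E] [T1Space E]
    {φ : ℝ → ℝ} {w : ℝ → E} {w₀ : E} {S : Set ℝ} {r t : ℝ} (hrt : r ≤ t)
    (hφ : ContinuousOn φ (Icc r t)) (hw : ContinuousOn w (Icc r t)) (hr : r ∈ S) (ht : t ∉ S)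
    (hle : ∀ x ∈ Icc r t, x ∈ S → φ r ≤ φ x) (heq : ∀ x ∈ Icc r t, x ∉ S → w x = w₀) :
    ∃ c ∈ Icc r t, φ r ≤ φ c ∧ w c = w₀ := by
  set A : Set ℝ := {x ∈ Icc r t | x ∈ S}
  have hAne : A.Nonempty := ⟨r, left_mem_Icc.2 hrt, hr⟩
  have hAbdd : BddAbove A := ⟨t, fun x hx => hx.1.2⟩
  have hc : sSup A ∈ Icc r t :=
    ⟨le_csSup hAbdd ⟨left_mem_Icc.2 hrt, hr⟩, csSup_le hAne fun x hx => hx.1.2⟩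
  refine ⟨sSup A, hc, ?_, ?_⟩
  · have hclosed : IsClosed (Icc r t ∩ φ ⁻¹' Ici (φ r)) :=
      hφ.preimage_isClosed_of_isClosed isClosed_Icc isClosed_Ici
    have hsub : A ⊆ Icc r t ∩ φ ⁻¹' Ici (φ r) := fun x hx => ⟨hx.1, hle x hx.1 hx.2⟩
    exact (closure_minimal hsub hclosed (csSup_mem_closure hAne hAbdd)).2
  · rcases hc.2.eq_or_lt with h | h
    · rw [h]
      exact heq t (right_mem_Icc.2 hrt) ht
    · have hclosed : IsClosed (Icc r t ∩ w ⁻¹' {w₀}) :=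
        hw.preimage_isClosed_of_isClosed isClosed_Icc isClosed_singleton
      have hsub : Ioc (sSup A) t ⊆ Icc r t ∩ w ⁻¹' {w₀} := fun x hx =>
        have hx' : x ∈ Icc r t := ⟨hc.1.trans hx.1.le, hx.2⟩
        ⟨hx', heq x hx' fun hxS => hx.1.not_ge (le_csSup hAbdd ⟨hx', hxS⟩)⟩
      refine (closure_minimal hsub hclosed ?_).2
      rw [closure_Ioc h.ne]
      exact left_mem_Icc.2 h.le

/-- **Monotonicity of the weighted distance between two solutions** (backward
Gronwall estimate from the proof of Proposition `dop`).  `E` is a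
finite-dimensional Euclidean space, `L` is locally integrable and nonnegative,
`M t = ∫_0^t L`, and `b` is measurable in `t`, continuous in `y` and
`L(t)`-Lipschitz in `y`.  If `y₁, y₂` are (absolutely continuous) solutions of
`ẏ = b(t,y)` on `[0,τ]` (integral form), then `t ↦ e^{M(t)} ‖y₁ t − y₂ t‖` is
nondecreasing on `[0,τ]`; in particular
`‖y₁ 0 − y₂ 0‖ ≤ e^{M(τ)} ‖y₁ τ − y₂ τ‖`. -/
theorem weighted_distance_monotone
    {E : Type*} [NormedAddCommGroup E] [InnerProductSpace ℝ E]
    [FiniteDimensional ℝ E] [MeasurableSpace E] [BorelSpace E]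
    (L M : ℝ → ℝ) (hL0 : ∀ t, 0 ≤ L t)
    (hLint : ∀ T : ℝ, IntegrableOn L (Icc 0 T))
    (hM : ∀ t : ℝ, M t = ∫ s in (0:ℝ)..t, L s)
    (b : ℝ → E → E)
    (hbmeas : ∀ y : E, Measurable fun t => b t y)
    (hbcont : ∀ t : ℝ, Continuous fun y => b t y)
    (hblip : ∀ (t : ℝ) (y₁ y₂ : E), ‖b t y₁ - b t y₂‖ ≤ L t * ‖y₁ - y₂‖)
    (hbext : ∀ t₀ ≥ (0:ℝ), ∀ y₀ : E, ∃ Y : ℝ → E, ContinuousOn Y (Ici 0) ∧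
        Y t₀ = y₀ ∧ ∀ t ≥ (0:ℝ), Y t = y₀ + ∫ s in t₀..t, b s (Y s))
    (τ : ℝ) (hτ : 0 ≤ τ)
    (y₁ y₂ : ℝ → E)
    (hy₁c : ContinuousOn y₁ (Icc 0 τ)) (hy₂c : ContinuousOn y₂ (Icc 0 τ))
    (hy₁ : ∀ t ∈ Icc (0:ℝ) τ, y₁ t = y₁ 0 + ∫ s in (0:ℝ)..t, b s (y₁ s))
    (hy₂ : ∀ t ∈ Icc (0:ℝ) τ, y₂ t = y₂ 0 + ∫ s in (0:ℝ)..t, b s (y₂ s)) :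
    MonotoneOn (fun t => Real.exp (M t) * ‖y₁ t - y₂ t‖) (Icc 0 τ) ∧
      ‖y₁ 0 - y₂ 0‖ ≤ Real.exp (M τ) * ‖y₁ τ - y₂ τ‖ := by
  have hLii : ∀ r t : ℝ, 0 ≤ r → r ≤ t → IntervalIntegrable L volume r t := fun r t hr hrt =>
    (intervalIntegrable_iff_integrableOn_Icc_of_le hrt).2
      ((hLint t).mono_set (Icc_subset_Icc_left hr))
  have hMsub : ∀ r t : ℝ, 0 ≤ r → r ≤ t → M t = M r + ∫ s in r..t, L s := fun r t hr hrt => by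
    rw [hM, hM, integral_add_adjacent_intervals (hLii 0 r le_rfl hr) (hLii r t hr hrt)]
  have hMmono : ∀ r t : ℝ, 0 ≤ r → r ≤ t → M r ≤ M t := fun r t hr hrt => by
    rw [hMsub r t hr hrt]
    exact le_add_of_nonneg_right (integral_nonneg hrt fun s _ => hL0 s)
  have hMcont : ContinuousOn M (Icc 0 τ) := by
    have h := continuousOn_primitive_interval (a := 0) (b := τ) (μ := volume) (f := L)
      (by rw [uIcc_of_le hτ]; exact hLint τ)
    rw [uIcc_of_le hτ] at h
    exact h.congr fun t _ => hM t
  set w : ℝ → E := fun t => y₁ t - y₂ t with hwdef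
  set D : ℝ → E := fun t => b t (y₁ t) - b t (y₂ t) with hDdef
  have hw : ContinuousOn w (Icc 0 τ) := hy₁c.sub hy₂c
  have hD : IntegrableOn D (Icc 0 τ) := by
    refine Integrable.mono' (g := fun t => L t * ‖w t‖)
      ((hLint τ).mul_continuousOn hw.norm isCompact_Icc)
      ((hy₁c.aestronglyMeasurable_caratheodory hbmeas hbcont measurableSet_Icc).sub
        (hy₂c.aestronglyMeasurable_caratheodory hbmeas hbcont measurableSet_Icc))
      (.of_forall fun t => hblip t _ _)
  have hDii : ∀ r t : ℝ, 0 ≤ r → r ≤ t → t ≤ τ → IntervalIntegrable D volume r t :=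
    fun r t hr hrt ht => (intervalIntegrable_iff_integrableOn_Icc_of_le hrt).2
      (hD.mono_set (Icc_subset_Icc hr ht))
  -- The integrals in `hy₁` and `hy₂` vanish by convention at the times outside `S`.
  set S : Set ℝ := {t | IntervalIntegrable (fun s => b s (y₁ s)) volume 0 t}
  have hwS : ∀ t ∈ Icc 0 τ, t ∈ S → w t = w 0 + ∫ s in (0:ℝ)..t, D s := by
    intro t ht htS
    have h₂ : IntervalIntegrable (fun s => b s (y₂ s)) volume 0 t :=
      (IntervalIntegrable.sub htS (hDii 0 t le_rfl ht.1 ht.2)).congr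
        (fun s _ => sub_sub_cancel _ _)
    simp only [hwdef, hDdef]
    rw [hy₁ t ht, hy₂ t ht, integral_sub htS h₂]
    abel
  have hwnS : ∀ t ∈ Icc 0 τ, t ∉ S → w t = w 0 := by
    intro t ht htS
    have h₂ : ¬ IntervalIntegrable (fun s => b s (y₂ s)) volume 0 t := fun h₂ =>
      htS (((hDii 0 t le_rfl ht.1 ht.2).add h₂).congr
        (fun s _ => sub_add_cancel _ _))
    simp only [hwdef]
    rw [hy₁ t ht, hy₂ t ht, integral_undef htS, integral_undef h₂, add_zero, add_zero]
  have hSdown : ∀ r t : ℝ, 0 ≤ r → r ≤ t → t ∈ S → r ∈ S := fun r t hr hrt ht =>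
    IntervalIntegrable.mono_set ht (uIcc_subset_uIcc_left (mem_uIcc_of_le hr hrt))
  have hmonoS : ∀ r t : ℝ, 0 ≤ r → r ≤ t → t ≤ τ → t ∈ S →
      Real.exp (M r) * ‖w r‖ ≤ Real.exp (M t) * ‖w t‖ := by
    intro r t hr hrt ht htS
    have hbase := norm_le_exp_integral_mul_norm (w := w) (g := D) hrt hL0 (hLii r t hr hrt)
      (hw.mono (Icc_subset_Icc hr ht)) (fun s _ => hblip s _ _) fun s hs => by
        have hs0 : 0 ≤ s := hr.trans hs.1
        rw [hwS t ⟨hr.trans hrt, ht⟩ htS,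
          hwS s ⟨hs0, hs.2.trans ht⟩ (hSdown s t hs0 hs.2 htS), add_assoc,
          integral_add_adjacent_intervals (hDii 0 s le_rfl hs0 (hs.2.trans ht))
            (hDii s t hs0 hs.2 ht)]
    rw [hMsub r t hr hrt, Real.exp_add, mul_assoc]
    gcongr
  have hmono : MonotoneOn (fun t => Real.exp (M t) * ‖w t‖) (Icc 0 τ) := by
    intro r hr t ht hrt
    by_cases htS : t ∈ S
    · exact hmonoS r t hr.1 hrt ht.2 htS
    · obtain ⟨c, hc, hrc, hwc⟩ : ∃ c ∈ Icc r t,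
          Real.exp (M r) * ‖w r‖ ≤ Real.exp (M c) * ‖w c‖ ∧ w c = w 0 := by
        by_cases hrS : r ∈ S
        · have hsub : Icc r t ⊆ Icc 0 τ := Icc_subset_Icc hr.1 ht.2
          exact exists_le_and_eq_of_notMem (φ := fun x => Real.exp (M x) * ‖w x‖) hrt
            ((hMcont.rexp.mul hw.norm).mono hsub) (hw.mono hsub) hrS htS
            (fun x hx hxS => hmonoS r x hr.1 hx.1 (hsub hx).2 hxS)
            (fun x hx hxS => hwnS x (hsub hx) hxS)
        · exact ⟨r, left_mem_Icc.2 hrt, le_rfl, hwnS r hr hrS⟩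
      refine hrc.trans ?_
      simp only [hwc, hwnS t ht htS]
      gcongr
      exact hMmono c t (hr.1.trans hc.1) hc.2
  refine ⟨hmono, ?_⟩
  have h := hmono (left_mem_Icc.2 hτ) (right_mem_Icc.2 hτ) hτ
  have hM0 : M 0 = 0 := by rw [hM, integral_same]
  simpa [hM0, hwdef] using h
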